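/- arXiv:2203.05496 — 4 statements merged into one kernel-verified Lean document; each statement's English description precedes it below -/
import Mathlib

section
/- Let F : ℝ → ℝ be defined by F(x) = 3·arcsin(x/2) − arcsin(x). Then F(x) > 0 for every x in the open interval (0,1). -/
theorem burago_zalgaller_F_pos (F : ℝ → ℝ)
    (hF : ∀ x : ℝ, F x = 3 * Real.arcsin (x / 2) - Real.arcsin x) :
    ∀ x ∈ Set.Ioo (0 : ℝ) 1, F x > 0 := by
  rintro x ⟨hx0, hx1⟩
  have hpi := Real.pi_pos
  have hpos : 0 ≤ Real.arcsin (x / 2) := Real.arcsin_nonneg.2 (by linarith)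
  have hle : Real.arcsin (x / 2) < Real.pi / 6 := by
    rw [Real.arcsin_lt_iff_lt_sin' ⟨by linarith, by linarith⟩, Real.sin_pi_div_six]
    linarith
  have hlt : Real.arcsin x < 3 * Real.arcsin (x / 2) := by
    rw [Real.arcsin_lt_iff_lt_sin' ⟨by linarith, by linarith⟩, Real.sin_three_mul,
      Real.sin_arcsin (by linarith) (by linarith)]
    have : 0 < x * (1 - x ^ 2) := mul_pos hx0 (by nlinarith)
    nlinarith
  rw [hF]
  linarith
end

section
/- Let α ∈ ℝ and h > 0. Set s₁ = sin²(α/2), s₂ = sin²(π/3 − α/2), and consider a Euclidean triangle with side lengths a = 1/3, b = √((4/27)·s₁ + h²), c = √((4/27)·s₂ + h²). Let p = (a+b+c)/2 be the half-perimeter and let h̄ = 2·√(p(p−a)(p−b)(p−c))/a (twice the Heron area divided by a). Then h̄² = h² + (2/27)(s₁ + s₂) − (4/81)(s₁ − s₂)² − 1/36. -/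
open Real

/-- Heron's formula, with the area expressed through the squares of the side lengths. -/
lemma heron_product_eq (a b c : ℝ) :
    (a + b + c) / 2 * ((a + b + c) / 2 - a) * ((a + b + c) / 2 - b) * ((a + b + c) / 2 - c) =
      (2 * a ^ 2 * (b ^ 2 + c ^ 2) - (a ^ 2) ^ 2 - (b ^ 2 - c ^ 2) ^ 2) / 16 := by
  ring

lemma sin_sq_half_add_sin_sq (α : ℝ) :
    sin (α / 2) ^ 2 + sin (π / 3 - α / 2) ^ 2 = 1 - cos (α - π / 3) / 2 := by
  have h₃ : √3 ^ 2 = (3 : ℝ) := sq_sqrt (by norm_num)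
  have h₁ := sin_sq_add_cos_sq (α / 2)
  have hα : α - π / 3 = 2 * (α / 2) - π / 3 := by ring
  rw [hα, cos_sub, sin_sub, cos_two_mul, sin_two_mul, sin_pi_div_three, cos_pi_div_three]
  linear_combination (5 / 4) * h₁ + (cos (α / 2) ^ 2 / 4) * h₃

lemma sin_sq_half_sub_sin_sq_sq (α : ℝ) :
    (sin (α / 2) ^ 2 - sin (π / 3 - α / 2) ^ 2) ^ 2 = 3 / 4 * (1 - cos (α - π / 3) ^ 2) := by
  have h₃ : √3 ^ 2 = (3 : ℝ) := sq_sqrt (by norm_num)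
  have h : sin (α / 2) ^ 2 - sin (π / 3 - α / 2) ^ 2 = √3 / 2 * sin (α - π / 3) := by
    have h₁ := sin_sq_add_cos_sq (α / 2)
    have hα : α - π / 3 = 2 * (α / 2) - π / 3 := by ring
    rw [hα, sin_sub (2 * _), sin_sub, cos_two_mul, sin_two_mul, sin_pi_div_three,
      cos_pi_div_three]
    linear_combination (3 / 4) * h₁ + (cos (α / 2) ^ 2 / 4 - 1 / 4) * h₃
  rw [h, mul_pow, div_pow, h₃, sin_sq]
  ring

theorem gasket_length_heron (α h : ℝ) (hh : 0 < h)
    (s₁ s₂ a b c p hbar : ℝ)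
    (hs₁ : s₁ = Real.sin (α / 2) ^ 2)
    (hs₂ : s₂ = Real.sin (π / 3 - α / 2) ^ 2)
    (ha : a = 1 / 3)
    (hb : b = Real.sqrt ((4 / 27) * s₁ + h ^ 2))
    (hc : c = Real.sqrt ((4 / 27) * s₂ + h ^ 2))
    (hp : p = (a + b + c) / 2)
    (hbar_def : hbar = 2 * Real.sqrt (p * (p - a) * (p - b) * (p - c)) / a) :
    hbar ^ 2 = h ^ 2 + (2 / 27) * (s₁ + s₂) - (4 / 81) * (s₁ - s₂) ^ 2 - 1 / 36 := by
  have hb2 : b ^ 2 = (4 / 27) * s₁ + h ^ 2 := by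
    rw [hb, sq_sqrt]
    rw [hs₁]; positivity
  have hc2 : c ^ 2 = (4 / 27) * s₂ + h ^ 2 := by
    rw [hc, sq_sqrt]
    rw [hs₂]; positivity
  have hprod : p * (p - a) * (p - b) * (p - c) =
      (h ^ 2 + (2 / 27) * (s₁ + s₂) - (4 / 81) * (s₁ - s₂) ^ 2 - 1 / 36) / 36 := by
    rw [hp, heron_product_eq, hb2, hc2, ha]
    ring
  have hnonneg : 0 ≤ h ^ 2 + (2 / 27) * (s₁ + s₂) - (4 / 81) * (s₁ - s₂) ^ 2 - 1 / 36 := by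
    have hsq : h ^ 2 + (2 / 27) * (s₁ + s₂) - (4 / 81) * (s₁ - s₂) ^ 2 - 1 / 36 =
        h ^ 2 + (cos (α - π / 3) - 1 / 2) ^ 2 / 27 := by
      rw [hs₁, hs₂, sin_sq_half_add_sin_sq, sin_sq_half_sub_sin_sq_sq]
      ring
    rw [hsq]
    positivity
  rw [hbar_def, div_pow, mul_pow, hprod, sq_sqrt (by positivity), ha]
  ring
end

section
/- For all real α and all real h, h² + (2/27)(sin²(α/2) + sin²(π/3 − α/2)) − (4/81)(sin²(α/2) − sin²(π/3 − α/2))² − 1/36 < h² + 1/9. -/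
open Real

lemma sin_sq_add_sin_pi_div_three_sub_sq_le (x : ℝ) :
    Real.sin x ^ 2 + Real.sin (π / 3 - x) ^ 2 ≤ 3 / 2 := by
  rw [Real.sin_sub, Real.sin_pi_div_three, Real.cos_pi_div_three]
  have h3 : √(3 : ℝ) ^ 2 = 3 := Real.sq_sqrt (by norm_num)
  have key : 3 / 2 - (Real.sin x ^ 2 + (√3 / 2 * Real.cos x - 1 / 2 * Real.sin x) ^ 2)
      = (Real.sin x / 2 + √3 / 2 * Real.cos x) ^ 2 := by
    linear_combination (-(Real.cos x ^ 2) / 2) * h3 - 3 / 2 * Real.sin_sq_add_cos_sq x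
  linarith [sq_nonneg (Real.sin x / 2 + √3 / 2 * Real.cos x)]

theorem gasket_length_bound (α h : ℝ) :
    h ^ 2 + (2 / 27) * (Real.sin (α / 2) ^ 2 + Real.sin (π / 3 - α / 2) ^ 2)
      - (4 / 81) * (Real.sin (α / 2) ^ 2 - Real.sin (π / 3 - α / 2) ^ 2) ^ 2 - 1 / 36
      < h ^ 2 + 1 / 9 := by
  linarith [sin_sq_add_sin_pi_div_three_sub_sq_le (α / 2),
    sq_nonneg (Real.sin (α / 2) ^ 2 - Real.sin (π / 3 - α / 2) ^ 2)]
end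

section
/- Let τ > 0 and R > r > 0 be real numbers. Set c = √(R² − r²)/(τ·r), m = √((R+r)/(R−r)), and define α : ℝ → ℝ by α(u) = (1/π)·arctan(m·tan(c·π·u)). Then for every u with cos(c·π·u) ≠ 0, α is differentiable at u and satisfies τ·α'(u) = cos(2π·α(u)) + R/r. -/
open Real

theorem cos_two_mul_arctan_eq (x : ℝ) :
    Real.cos (2 * Real.arctan x) = 2 / (1 + x ^ 2) - 1 := by
  rw [Real.cos_two_mul, Real.cos_sq_arctan]
  ring

theorem sqrt_div_mul_sqrt_sq_sub_sq {R r : ℝ} (hr : 0 < r) (hRr : r < R) :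
    Real.sqrt ((R + r) / (R - r)) * Real.sqrt (R ^ 2 - r ^ 2) = R + r := by
  have hsub : 0 < R - r := sub_pos.mpr hRr
  have hadd : 0 < R + r := by linarith
  rw [← Real.sqrt_mul (by positivity),
    show (R + r) / (R - r) * (R ^ 2 - r ^ 2) = (R + r) ^ 2 by field_simp; ring]
  exact Real.sqrt_sq hadd.le

theorem hasDerivAt_arctan_mul_tan (m k : ℝ) {u : ℝ} (hu : Real.cos (k * u) ≠ 0) :
    HasDerivAt (fun v => Real.arctan (m * Real.tan (k * v)))
      (m * k * (1 + Real.tan (k * u) ^ 2) / (1 + (m * Real.tan (k * u)) ^ 2)) u := by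
  have hlin : HasDerivAt (fun v => k * v) k u := by
    simpa using (hasDerivAt_id u).const_mul k
  have htan := (((Real.hasDerivAt_tan hu).comp u hlin).const_mul m).arctan
  have hsec : 1 / Real.cos (k * u) ^ 2 = 1 + Real.tan (k * u) ^ 2 := by
    rw [← Real.inv_one_add_tan_sq hu, one_div, inv_inv]
  refine htan.congr_deriv ?_
  rw [hsec, Function.comp_apply]
  ring

theorem conformal_ode_solution (τ R r : ℝ) (hτ : 0 < τ) (hr : 0 < r) (hRr : r < R)
    (c m : ℝ)
    (hc : c = Real.sqrt (R ^ 2 - r ^ 2) / (τ * r))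
    (hm : m = Real.sqrt ((R + r) / (R - r)))
    (α : ℝ → ℝ)
    (hα : ∀ u : ℝ, α u = (1 / π) * Real.arctan (m * Real.tan (c * π * u))) :
    ∀ u : ℝ, Real.cos (c * π * u) ≠ 0 →
      DifferentiableAt ℝ α u ∧ τ * deriv α u = Real.cos (2 * π * α u) + R / r := by
  intro u hu
  have hderiv := (hasDerivAt_arctan_mul_tan m (c * π) hu).const_mul (1 / π)
  rw [← funext hα] at hderiv
  refine ⟨hderiv.differentiableAt, ?_⟩
  have hangle : 2 * π * α u = 2 * Real.arctan (m * Real.tan (c * π * u)) := by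
    rw [hα]
    field_simp
  rw [hderiv.deriv, hangle, cos_two_mul_arctan_eq]
  have hsub : 0 < R - r := sub_pos.mpr hRr
  have hadd : 0 < R + r := by linarith
  have hmsq : m ^ 2 * (R - r) = R + r := by
    rw [hm, Real.sq_sqrt (by positivity)]
    field_simp
  have hmc : m * c * τ * r = R + r := by
    rw [← sqrt_div_mul_sqrt_sq_sub_sq hr hRr, ← hm, hc]
    field_simp
  generalize Real.tan (c * π * u) = t
  have hden : 1 + (m * t) ^ 2 ≠ 0 := by positivity
  have hpi := Real.pi_ne_zero
  have hlhs : τ * (1 / π * (m * (c * π) * (1 + t ^ 2) / (1 + (m * t) ^ 2))) =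
      (m * c * τ * r) * (1 + t ^ 2) / (r * (1 + (m * t) ^ 2)) := by
    field_simp
  have hrhs : 2 / (1 + (m * t) ^ 2) - 1 + R / r =
      (R + r + m ^ 2 * (R - r) * t ^ 2) / (r * (1 + (m * t) ^ 2)) := by
    field_simp
    ring
  rw [hlhs, hrhs, hmc, hmsq]
  ring
end
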